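/- Let 0 < α < 1 and let p ≠ q be integers. Set μ₁ = (2q+α)/(2(q−p)) and μ₂ = (2p+α)/(2(p−q)), and for real θ with 0 < |θ| < 2π define W_r(θ) = (iθ)^α (1 − e^{−iθ})^{−α} e^{irθ} (principal branch powers). Then there exist constants δ > 0 and C > 0 such that for all θ with 0 < |θ| < δ, |μ₁ W_p(θ) + μ₂ W_q(θ) − 1| ≤ C θ². -/

import Mathlib

/-- `W_r(θ) = (iθ)^α (1 − e^{−iθ})^{−α} e^{irθ}`, with principal-branch complex powers. -/
noncomputable def Wfun (α : ℝ) (r : ℤ) (θ : ℝ) : ℂ :=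
  (Complex.I * (θ : ℂ)) ^ (α : ℂ) * (1 - Complex.exp (-(Complex.I * (θ : ℂ)))) ^ (-(α : ℂ)) *
    Complex.exp (Complex.I * (r : ℂ) * (θ : ℂ))

/-- Bounds for `sin (θ/2) / (θ/2)`. -/
lemma sinc_bounds (θ : ℝ) (h0 : 0 < |θ|) (h1 : |θ| < 1) :
    1 - θ ^ 2 / 16 ≤ Real.sin (θ / 2) / (θ / 2) ∧ Real.sin (θ / 2) / (θ / 2) ≤ 1 := by
  have key : ∀ x : ℝ, 0 < x → x < 1 →
      1 - x ^ 2 / 16 ≤ Real.sin (x / 2) / (x / 2) ∧ Real.sin (x / 2) / (x / 2) ≤ 1 := by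
    intro x hx hx1
    have a := Real.sin_gt_sub_cube (x := x / 2) (by linarith)
    have b := Real.sin_lt (x := x / 2) (by linarith)
    constructor
    · rw [le_div_iff₀ (by linarith)]
      nlinarith [pow_pos hx 3]
    · rw [div_le_one (by linarith)]
      exact b.le
  have := key |θ| h0 h1
  rcases abs_choice θ with h | h
  · rwa [h] at this
  · rw [h] at this
    rwa [neg_div, Real.sin_neg, neg_div_neg_eq, neg_sq] at this

lemma Wfun_eq (α : ℝ) (r : ℤ) (θ : ℝ) (h0 : 0 < |θ|) (h1 : |θ| < 1) :
    Wfun α r θ = (((Real.sin (θ / 2) / (θ / 2)) ^ (-α) : ℝ) : ℂ) *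
      Complex.exp (Complex.I * (((r + α / 2) * θ : ℝ) : ℂ)) := by
  obtain ⟨hl, hu⟩ := sinc_bounds θ h0 h1
  have hθ : θ ≠ 0 := abs_pos.mp h0
  have hθc : (θ : ℂ) ≠ 0 := by exact_mod_cast hθ
  obtain ⟨h1a, h1b⟩ := abs_lt.mp h1
  set s := Real.sin (θ / 2) / (θ / 2) with hs
  have hspos : 0 < s := by nlinarith
  have hz : Complex.I * (θ : ℂ) ≠ 0 := mul_ne_zero Complex.I_ne_zero hθc
  have hexp : Complex.exp (Complex.log (Complex.I * θ) + (((Real.log s : ℝ) : ℂ) - Complex.I * θ / 2))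
      = 1 - Complex.exp (-(Complex.I * (θ : ℂ))) := by
    rw [Complex.exp_add, Complex.exp_log hz, sub_eq_add_neg, Complex.exp_add, ← Complex.ofReal_exp,
      Real.exp_log hspos, hs]
    push_cast
    rw [Complex.sin]
    have e1 : Complex.exp (-(θ / 2 : ℂ) * Complex.I) = Complex.exp (-(Complex.I * θ / 2)) := by
      congr 1; ring
    have e2 : Complex.exp ((θ / 2 : ℂ) * Complex.I) * Complex.exp (-(Complex.I * θ / 2)) = 1 := by
      rw [← Complex.exp_add, ← Complex.exp_zero]; congr 1; ring
    have e3 : Complex.exp (-(Complex.I * θ / 2)) * Complex.exp (-(Complex.I * θ / 2))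
        = Complex.exp (-(Complex.I * (θ : ℂ))) := by
      rw [← Complex.exp_add]; congr 1; ring
    rw [e1, ← e3, ← e2]
    generalize Complex.exp (-(Complex.I * θ / 2)) = u
    generalize Complex.exp ((θ / 2 : ℂ) * Complex.I) = v
    field_simp
    linear_combination (u - v) * u * Complex.I_sq
  have harg : |Complex.arg (Complex.I * θ)| ≤ Real.pi / 2 := by
    rw [Complex.abs_arg_le_pi_div_two_iff]; simp
  obtain ⟨ha, hb⟩ := abs_le.mp harg
  have hpi := Real.pi_gt_three
  have him : (Complex.log (Complex.I * θ) + (((Real.log s : ℝ) : ℂ) - Complex.I * θ / 2)).im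
      = Complex.arg (Complex.I * θ) - θ / 2 := by
    have : Complex.I * (θ : ℂ) / 2 = Complex.I * ((θ / 2 : ℝ) : ℂ) := by push_cast; ring
    rw [this, Complex.add_im, Complex.sub_im, Complex.log_im, Complex.ofReal_im, Complex.I_mul_im,
      Complex.ofReal_re]
    ring
  have hlog : Complex.log (1 - Complex.exp (-(Complex.I * (θ : ℂ)))) =
      Complex.log (Complex.I * θ) + (((Real.log s : ℝ) : ℂ) - Complex.I * θ / 2) := by
    rw [← hexp, Complex.log_exp]
    · rw [him]; linarith
    · rw [him]; linarith
  have hw : 1 - Complex.exp (-(Complex.I * (θ : ℂ))) ≠ 0 := by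
    rw [← hexp]; exact Complex.exp_ne_zero _
  rw [Wfun, Complex.cpow_def_of_ne_zero hz, Complex.cpow_def_of_ne_zero hw, hlog,
    Real.rpow_def_of_pos hspos, Complex.ofReal_exp, ← Complex.exp_add, ← Complex.exp_add,
    ← Complex.exp_add]
  congr 1
  push_cast
  ring

lemma exp_I_bound (a θ : ℝ) (h : |a * θ| ≤ 1) :
    ‖Complex.exp (Complex.I * ((a * θ : ℝ) : ℂ)) - 1 - Complex.I * ((a * θ : ℝ) : ℂ)‖
      ≤ a ^ 2 * θ ^ 2 := by
  have hn : ‖Complex.I * ((a * θ : ℝ) : ℂ)‖ = |a * θ| := by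
    rw [norm_mul, Complex.norm_I, one_mul, Complex.norm_real, Real.norm_eq_abs]
  have := Complex.norm_exp_sub_one_sub_id_le (x := Complex.I * ((a * θ : ℝ) : ℂ)) (by rw [hn]; exact h)
  rw [hn, sq_abs, mul_pow] at this
  exact this

theorem weighted_Wfun_expansion (α : ℝ) (hα0 : 0 < α) (hα1 : α < 1)
    (p q : ℤ) (hpq : p ≠ q)
    (μ₁ μ₂ : ℝ)
    (hμ₁ : μ₁ = (2 * (q : ℝ) + α) / (2 * ((q : ℝ) - (p : ℝ))))
    (hμ₂ : μ₂ = (2 * (p : ℝ) + α) / (2 * ((p : ℝ) - (q : ℝ)))) :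
    ∃ δ > 0, ∃ C > 0, ∀ θ : ℝ, 0 < |θ| → |θ| < δ →
      ‖(μ₁ : ℂ) * Wfun α p θ + (μ₂ : ℂ) * Wfun α q θ - 1‖ ≤ C * θ ^ 2 := by
  have hpq' : (p : ℝ) - q ≠ 0 := sub_ne_zero.mpr (by exact_mod_cast hpq)
  have hqp' : (q : ℝ) - p ≠ 0 := sub_ne_zero.mpr (by exact_mod_cast hpq.symm)
  have hneg : (p : ℝ) - q = -((q : ℝ) - p) := by ring
  obtain ⟨a, ha⟩ : ∃ a : ℝ, a = p + α / 2 := ⟨_, rfl⟩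
  obtain ⟨b, hb⟩ : ∃ b : ℝ, b = q + α / 2 := ⟨_, rfl⟩
  have hsum : μ₁ + μ₂ = 1 := by
    rw [hμ₁, hμ₂, hneg]; field_simp; ring
  have hwt : μ₁ * a + μ₂ * b = 0 := by
    rw [hμ₁, hμ₂, ha, hb, hneg]; field_simp; ring
  have hA : 0 < 1 + |a| + |b| := by positivity
  refine ⟨1 / (1 + |a| + |b|), by positivity,
    2 * (|μ₁| * a ^ 2 + |μ₂| * b ^ 2) + 1, by positivity, ?_⟩
  intro θ h0 hδ
  rw [lt_div_iff₀ hA] at hδ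
  have hnn := h0.le
  have h1 : |θ| < 1 := by nlinarith [abs_nonneg a, abs_nonneg b]
  have hat : |a * θ| ≤ 1 := by rw [abs_mul]; nlinarith [abs_nonneg a, abs_nonneg b]
  have hbt : |b * θ| ≤ 1 := by rw [abs_mul]; nlinarith [abs_nonneg a, abs_nonneg b]
  rw [Wfun_eq α p θ h0 h1, Wfun_eq α q θ h0 h1, ← ha, ← hb]
  obtain ⟨hl, hu⟩ := sinc_bounds θ h0 h1
  set s := Real.sin (θ / 2) / (θ / 2) with hs
  have hθ2 : θ ^ 2 < 1 := by rw [← sq_abs]; nlinarith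
  have hθ2' : 0 ≤ θ ^ 2 := sq_nonneg θ
  have hspos : 0 < s := by linarith
  have ht1 : 1 ≤ s ^ (-α) := Real.one_le_rpow_of_pos_of_le_one_of_nonpos hspos hu (by linarith)
  have ht2 : s ^ (-α) ≤ 1 + θ ^ 2 := by
    have : s ^ (-α) ≤ s ^ (-1 : ℝ) := Real.rpow_le_rpow_of_exponent_ge hspos hu (by linarith)
    rw [Real.rpow_neg_one] at this
    refine this.trans ?_
    rw [inv_le_iff_one_le_mul₀ hspos]
    nlinarith
  set t := s ^ (-α) with ht
  have Ba := exp_I_bound a θ hat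
  have Bb := exp_I_bound b θ hbt
  set Ea := Complex.exp (Complex.I * ((a * θ : ℝ) : ℂ))
  set Eb := Complex.exp (Complex.I * ((b * θ : ℝ) : ℂ))
  have hsumc : (μ₁ : ℂ) + μ₂ = 1 := by exact_mod_cast hsum
  have hwtc : (μ₁ : ℂ) * a + μ₂ * b = 0 := by exact_mod_cast hwt
  have hdec : (μ₁ : ℂ) * ((t : ℂ) * Ea) + (μ₂ : ℂ) * ((t : ℂ) * Eb) - 1 =
      (t : ℂ) * ((μ₁ : ℂ) * (Ea - 1 - Complex.I * ((a * θ : ℝ) : ℂ)) +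
        (μ₂ : ℂ) * (Eb - 1 - Complex.I * ((b * θ : ℝ) : ℂ))) + ((t - 1 : ℝ) : ℂ) := by
    push_cast
    linear_combination (t : ℂ) * hsumc + (t : ℂ) * Complex.I * θ * hwtc
  rw [hdec]
  have hin : ‖(μ₁ : ℂ) * (Ea - 1 - Complex.I * ((a * θ : ℝ) : ℂ)) +
        (μ₂ : ℂ) * (Eb - 1 - Complex.I * ((b * θ : ℝ) : ℂ))‖
        ≤ |μ₁| * (a ^ 2 * θ ^ 2) + |μ₂| * (b ^ 2 * θ ^ 2) := by
    refine (norm_add_le _ _).trans ?_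
    rw [norm_mul, norm_mul, Complex.norm_real, Complex.norm_real, Real.norm_eq_abs,
      Real.norm_eq_abs]
    gcongr
  refine (norm_add_le _ _).trans ?_
  rw [norm_mul, Complex.norm_real, Complex.norm_real, Real.norm_of_nonneg (by linarith : 0 ≤ t),
    Real.norm_of_nonneg (by linarith : 0 ≤ t - 1)]
  have hm := mul_le_mul (by linarith : t ≤ 2) hin (norm_nonneg _) (by norm_num)
  linarith
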